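/- Let Ω ⊆ ℝ^d be a nonempty bounded open convex set. For each i, let v₁ⁱ,…,v_dⁱ ∈ ∂Ω be d affinely independent points such that Fᵢ = int(conv{v₁ⁱ,…,v_dⁱ}) is a flat of Ω. Suppose that for each j the sequence (vⱼⁱ)ᵢ converges to a point vⱼ, and that there exists x ∈ Ω with x ∈ conv{v₁,…,v_d}. Then v₁,…,v_d are affinely independent points of ∂Ω and int(conv{v₁,…,v_d}) is a flat of Ω. -/

import Mathlib

open Set Filter

noncomputable section

/-- `ℝ^d`. -/
abbrev Euc (d : ℕ) := EuclideanSpace ℝ (Fin d)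

/-- A flat of `Ω` with prescribed vertices `v`: the vertices are `d` affinely independent
boundary points, the intrinsic interior of their convex hull lies in `Ω`, and the rest of
the hull lies in `∂Ω`. -/
def IsFlatWith {d : ℕ} (Ω : Set (Euc d)) (v : Fin d → Euc d) : Prop :=
  AffineIndependent ℝ v ∧
  (∀ j, v j ∈ closure Ω \ Ω) ∧
  intrinsicInterior ℝ (convexHull ℝ (Set.range v)) ⊆ Ω ∧
  convexHull ℝ (Set.range v) \ intrinsicInterior ℝ (convexHull ℝ (Set.range v)) ⊆ closure Ω \ Ω

theorem mem_convexHull_range_iff_exists_weights {ι E : Type*} [Fintype ι] [AddCommGroup E]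
    [Module ℝ E] {v : ι → E} {x : E} :
    x ∈ convexHull ℝ (Set.range v) ↔
      ∃ a : ι → ℝ, (∀ k, 0 ≤ a k) ∧ ∑ k, a k = 1 ∧ ∑ k, a k • v k = x := by
  classical
  constructor
  · intro hx
    have hrange : Set.range v = Fintype.linearCombination ℝ v ''
        Set.range fun i => Pi.single i (1 : ℝ) := by
      rw [← Set.range_comp]
      congr 1
      ext i
      simp
    rw [hrange, ← LinearMap.image_convexHull, convexHull_rangle_single_eq_stdSimplex] at hx
    obtain ⟨a, ⟨ha, ha1⟩, rfl⟩ := hx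
    exact ⟨a, ha, ha1, rfl⟩
  · rintro ⟨a, ha, ha1, rfl⟩
    exact (convex_convexHull ℝ _).sum_mem (fun k _ => ha k) ha1
      fun k _ => subset_convexHull ℝ _ (Set.mem_range_self k)

section IntrinsicInterior

variable {E : Type*} [NormedAddCommGroup E] [NormedSpace ℝ E]

theorem mem_intrinsicInterior_iff_mem_nhdsWithin {s : Set E} {y : E} :
    y ∈ intrinsicInterior ℝ s ↔
      y ∈ affineSpan ℝ s ∧ s ∈ nhdsWithin y (affineSpan ℝ s : Set E) := by
  rw [mem_intrinsicInterior]
  constructor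
  · rintro ⟨⟨y, hy⟩, h, rfl⟩
    refine ⟨hy, ?_⟩
    exact (preimage_coe_mem_nhds_subtype (a := ⟨y, hy⟩)).1 (mem_interior_iff_mem_nhds.1 h)
  · rintro ⟨hy, h⟩
    exact ⟨⟨y, hy⟩, mem_interior_iff_mem_nhds.2
      ((preimage_coe_mem_nhds_subtype (a := ⟨y, hy⟩)).2 h), rfl⟩

/-- A segment ending at a point of the intrinsic interior can be prolonged inside the set. -/
theorem exists_lineMap_mem_of_mem_intrinsicInterior {s : Set E} {p y : E} (hp : p ∈ s)
    (hy : y ∈ intrinsicInterior ℝ s) :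
    ∃ t : ℝ, 0 < t ∧ AffineMap.lineMap p y (1 + t) ∈ s := by
  obtain ⟨hyA, hs⟩ := mem_intrinsicInterior_iff_mem_nhdsWithin.1 hy
  have hcont : Continuous fun t : ℝ => (AffineMap.lineMap p y (1 + t) : E) :=
    AffineMap.lineMap_continuous.comp (by fun_prop)
  have ht : Tendsto (fun t : ℝ => (AffineMap.lineMap p y (1 + t) : E)) (nhdsWithin 0 (Ioi 0))
      (nhdsWithin y (affineSpan ℝ s : Set E)) := by
    refine tendsto_nhdsWithin_iff.2 ⟨?_, Eventually.of_forall fun t =>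
      AffineMap.lineMap_mem _ (subset_affineSpan ℝ s hp) hyA⟩
    have := hcont.tendsto 0
    simp only [add_zero, AffineMap.lineMap_apply_one] at this
    exact this.mono_left nhdsWithin_le_nhds
  obtain ⟨t, hts, ht0⟩ := ((ht.eventually hs).and self_mem_nhdsWithin).exists
  exact ⟨t, ht0, hts⟩

theorem Convex.lineMap_mem_intrinsicInterior {s : Set E} (hs : Convex ℝ s) {u z : E} (hu : u ∈ s)
    (hz : z ∈ intrinsicInterior ℝ s) {r : ℝ} (hr : 0 < r) (hr1 : r ≤ 1) :
    AffineMap.lineMap u z r ∈ intrinsicInterior ℝ s := by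
  obtain ⟨hzA, hzs⟩ := mem_intrinsicInterior_iff_mem_nhdsWithin.1 hz
  have huA := subset_affineSpan ℝ s hu
  refine mem_intrinsicInterior_iff_mem_nhdsWithin.2 ⟨AffineMap.lineMap_mem _ huA hzA, ?_⟩
  have hg : Tendsto (fun y : E => (AffineMap.lineMap u y r⁻¹ : E))
      (nhdsWithin (AffineMap.lineMap u z r) (affineSpan ℝ s : Set E))
      (nhdsWithin z (affineSpan ℝ s : Set E)) := by
    refine tendsto_nhdsWithin_iff.2 ⟨?_, ?_⟩
    · have hcont : Continuous fun y : E => (AffineMap.lineMap u y r⁻¹ : E) := by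
        simp only [AffineMap.lineMap_apply_module']
        fun_prop
      have := hcont.tendsto (AffineMap.lineMap u z r)
      have hz' : (AffineMap.lineMap u (AffineMap.lineMap u z r : E) r⁻¹ : E) = z := by
        simp [AffineMap.lineMap_apply_module', smul_smul, hr.ne']
      rw [hz'] at this
      exact this.mono_left nhdsWithin_le_nhds
    · filter_upwards [self_mem_nhdsWithin] with y hy
      exact AffineMap.lineMap_mem _ huA hy
  filter_upwards [hg.eventually hzs] with y hy
  have hy' : (AffineMap.lineMap u (AffineMap.lineMap u y r⁻¹ : E) r : E) = y := by
    simp [AffineMap.lineMap_apply_module', smul_smul, hr.ne']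
  rw [← hy']
  exact hs.segment_subset hu hy (lineMap_mem_segment ℝ _ _ ⟨hr.le, hr1⟩)

variable {ι : Type*} [Fintype ι] {v : ι → E} {a : ι → ℝ}

/-- The intrinsic interior of a simplex does not meet its facets. -/
theorem AffineIndependent.sum_smul_notMem_intrinsicInterior_convexHull
    (hv : AffineIndependent ℝ v) (ha1 : ∑ k, a k = 1) {j : ι} (haj : a j = 0) :
    ∑ k, a k • v k ∉ intrinsicInterior ℝ (convexHull ℝ (Set.range v)) := by
  classical
  intro hy
  obtain ⟨t, ht, hq⟩ := exists_lineMap_mem_of_mem_intrinsicInterior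
    (subset_convexHull ℝ _ (Set.mem_range_self j)) hy
  obtain ⟨b, hb, hb1, hbq⟩ := mem_convexHull_range_iff_exists_weights.1 hq
  have hc := affineIndependent_iff.1 hv Finset.univ
    (fun k => (1 + t) * a k - t * (if k = j then 1 else 0) - b k)
    (by simp [Finset.sum_sub_distrib, ← Finset.mul_sum, ha1, hb1])
    (by
      simp only [sub_smul, mul_smul, Finset.sum_sub_distrib, ← Finset.smul_sum, hbq, ite_smul,
        one_smul, zero_smul, Finset.sum_ite_eq', Finset.mem_univ, if_true,
        AffineMap.lineMap_apply_module]
      module) j (Finset.mem_univ j)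
  simp only [haj, if_true] at hc
  linarith [hb j]

/-- Points with positive weights lie in the intrinsic interior of the convex hull. -/
theorem sum_smul_mem_intrinsicInterior_convexHull [Nonempty ι] [FiniteDimensional ℝ E]
    (ha : ∀ k, 0 < a k) (ha1 : ∑ k, a k = 1) :
    ∑ k, a k • v k ∈ intrinsicInterior ℝ (convexHull ℝ (Set.range v)) := by
  obtain ⟨z, hz⟩ := (Set.range_nonempty v).convexHull.intrinsicInterior (convex_convexHull ℝ _)
  obtain ⟨b, hb, hb1, rfl⟩ :=
    mem_convexHull_range_iff_exists_weights.1 (intrinsicInterior_subset hz)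
  obtain ⟨r, ⟨hr1, hr⟩, hr0⟩ : ∃ r : ℝ, (r < 1 ∧ ∀ k, r * b k < a k) ∧ 0 < r := by
    have hev : ∀ᶠ r : ℝ in nhds 0, r < 1 ∧ ∀ k, r * b k < a k := by
      refine (eventually_lt_nhds one_pos).and (eventually_all.2 fun k => ?_)
      have hcont : Continuous fun r : ℝ => r * b k := by fun_prop
      exact hcont.tendsto 0 |>.eventually_lt_const (by simpa using ha k)
    exact ((hev.filter_mono nhdsWithin_le_nhds).and
      (self_mem_nhdsWithin (s := Ioi (0 : ℝ)))).exists
  have hr' : 0 < 1 - r := by linarith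
  have hu : ∑ k, ((1 - r)⁻¹ * (a k - r * b k)) • v k ∈ convexHull ℝ (Set.range v) := by
    refine mem_convexHull_range_iff_exists_weights.2 ⟨_, fun k => ?_, ?_, rfl⟩
    · exact mul_nonneg (inv_nonneg.2 hr'.le) (sub_nonneg.2 (hr k).le)
    · rw [← Finset.mul_sum, Finset.sum_sub_distrib, ← Finset.mul_sum, ha1, hb1, mul_one,
        inv_mul_cancel₀ hr'.ne']
  have key : ∑ k, a k • v k = AffineMap.lineMap
      (∑ k, ((1 - r)⁻¹ * (a k - r * b k)) • v k) (∑ k, b k • v k) r := by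
    simp only [AffineMap.lineMap_apply_module, Finset.smul_sum, smul_smul,
      ← Finset.sum_add_distrib, ← add_smul]
    refine Finset.sum_congr rfl fun k _ => ?_
    rw [mul_inv_cancel_left₀ hr'.ne', sub_add_cancel]
  rw [key]
  exact (convex_convexHull ℝ _).lineMap_mem_intrinsicInterior hu hz hr0 hr1.le

end IntrinsicInterior

/-- If a point of the convex hull of a finite family is in no hull of a proper subfamily, then
the family is affinely independent. -/
theorem affineIndependent_of_weights_ne_zero {ι E : Type*} [Fintype ι] [AddCommGroup E]
    [Module ℝ E] {w : ι → E} {x : E} (hx : x ∈ convexHull ℝ (Set.range w))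
    (h : ∀ a : ι → ℝ, (∀ k, 0 ≤ a k) → ∑ k, a k = 1 → ∑ k, a k • w k = x → ∀ k, a k ≠ 0) :
    AffineIndependent ℝ w := by
  classical
  obtain ⟨κ, _, z, b, hz, hzi, hb, hb1, hbx⟩ := eq_pos_convex_span_of_mem_convexHull hx
  choose s hs using fun i => hz (Set.mem_range_self i)
  have hsurj : Function.Surjective s := by
    intro j
    by_contra! hj
    refine h (fun k => ∑ i with s i = k, b i) (fun k => Finset.sum_nonneg fun i _ => (hb i).le)
      ?_ ?_ j ?_
    · exact (Finset.sum_fiberwise Finset.univ s b).trans hb1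
    · rw [← hbx, ← Finset.sum_fiberwise _ s]
      refine Finset.sum_congr rfl fun k _ => ?_
      rw [Finset.sum_smul]
      refine Finset.sum_congr rfl fun i hi => ?_
      rw [← hs i, (Finset.mem_filter.1 hi).2]
    · exact Finset.sum_eq_zero fun i hi => absurd (Finset.mem_filter.1 hi).2 (hj i)
  have hw : w = z ∘ Function.surjInv hsurj := by
    ext1 k
    rw [Function.comp_apply, ← hs, Function.surjInv_eq hsurj]
  rw [hw]
  exact hzi.comp_embedding ⟨_, Function.injective_surjInv hsurj⟩

/-- The collection of flats of `Ω` is closed in the geometric topology: a vertexwise limit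
of flats whose limit hull meets `Ω` is again a flat. -/
theorem limit_of_flats_is_flat {d : ℕ}
    (Ω : Set (Euc d)) (hne : Ω.Nonempty) (hbd : Bornology.IsBounded Ω)
    (hop : IsOpen Ω) (hconv : Convex ℝ Ω)
    (v : ℕ → Fin d → Euc d) (hv : ∀ i, IsFlatWith Ω (v i))
    (w : Fin d → Euc d) (hconvg : ∀ j, Tendsto (fun i => v i j) atTop (nhds (w j)))
    (x : Euc d) (hx : x ∈ Ω) (hxw : x ∈ convexHull ℝ (Set.range w)) :
    IsFlatWith Ω w := by
  have hclosed : IsClosed (closure Ω \ Ω) := isClosed_closure.sdiff hop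
  have hfacet : ∀ a : Fin d → ℝ, (∀ k, 0 ≤ a k) → ∑ k, a k = 1 → ∀ j, a j = 0 →
      ∑ k, a k • w k ∈ closure Ω \ Ω := by
    intro a ha ha1 j haj
    refine hclosed.mem_of_tendsto
      (tendsto_finsetSum _ fun k _ => (hconvg k).const_smul (a k))
      (Eventually.of_forall fun i => (hv i).2.2.2 ⟨?_, ?_⟩)
    · exact mem_convexHull_range_iff_exists_weights.2 ⟨a, ha, ha1, rfl⟩
    · exact (hv i).1.sum_smul_notMem_intrinsicInterior_convexHull ha1 haj
  have hvert : ∀ j, w j ∈ closure Ω \ Ω := fun j =>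
    hclosed.mem_of_tendsto (hconvg j) (Eventually.of_forall fun i => (hv i).2.1 j)
  have hsub : convexHull ℝ (Set.range w) ⊆ closure Ω :=
    convexHull_min (Set.range_subset_iff.2 fun j => (hvert j).1) hconv.closure
  refine ⟨affineIndependent_of_weights_ne_zero hxw ?_, hvert, ?_, ?_⟩
  · rintro a ha ha1 rfl k hk
    exact (hfacet a ha ha1 k hk).2 hx
  · intro y hy
    obtain ⟨t, ht, hq⟩ := exists_lineMap_mem_of_mem_intrinsicInterior hxw hy
    have hseg := hconv.openSegment_interior_closure_subset_interior
      (hop.interior_eq.symm ▸ hx) (hsub hq)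
    rw [hop.interior_eq] at hseg
    refine hseg ⟨t / (1 + t), 1 / (1 + t), by positivity, by positivity, by field_simp; ring, ?_⟩
    have ht' : 1 + t ≠ 0 := by positivity
    rw [AffineMap.lineMap_apply_module, smul_add, smul_smul, smul_smul, ← add_assoc, ← add_smul]
    have h1 : t / (1 + t) + 1 / (1 + t) * (1 - (1 + t)) = 0 := by field_simp; ring
    have h2 : 1 / (1 + t) * (1 + t) = 1 := by field_simp
    rw [h1, h2, zero_smul, one_smul, zero_add]
  · rintro y ⟨hy, hyi⟩
    obtain ⟨a, ha, ha1, rfl⟩ := mem_convexHull_range_iff_exists_weights.1 hy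
    by_cases h : ∃ j, a j = 0
    · obtain ⟨j, hj⟩ := h
      exact hfacet a ha ha1 j hj
    · push Not at h
      have : Nonempty (Fin d) := by
        by_contra hd
        rw [not_nonempty_iff] at hd
        simp at ha1
      exact absurd (sum_smul_mem_intrinsicInterior_convexHull
        (fun k => (ha k).lt_of_ne' (h k)) ha1) hyi
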